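/- arXiv:1108.5570 — 6 statements merged into one kernel-verified Lean document; each statement's English description precedes it below -/
import Mathlib

section
/- Let E be a finite-dimensional real vector space, N ⊆ E a subspace, and F : E → ℝ a linear functional. Define Σ_F = {(x,p) ∈ E × E* : x ∈ N and p(v) = F(v) for all v ∈ N}. Then (i) Σ_F = {(x, F + ξ) : x ∈ N, ξ ∈ N°}, i.e. Σ_F is the affine subspace through (0,F) with direction subspace N × N°; and (ii) Σ_F is affine-Lagrangian for the canonical symplectic pairing ω: for any three points σ₁, σ₂, σ₃ ∈ Σ_F one has ω(σ₁ − σ₂, σ₃ − σ₂) = 0, and the direction subspace N × N° has dimension dim E = ½ dim(E × E*). This is the linear model of Tulczyjew's theorem (Theorem 2.1 of the paper) that Σ_f = {p ∈ T*M : π_M(p) ∈ N and ⟨p,v⟩ = ⟨df,v⟩ for all v ∈ TN over π_M(p)} is a Lagrangian submanifold of T*M. -/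
/-- The linear model of the Tulczyjew manifold
`Σ_F = {(x,p) ∈ E × E* | x ∈ N and p(v) = F(v) for all v ∈ N}`. -/
def SigmaF (E : Type*) [AddCommGroup E] [Module ℝ E]
    (N : Submodule ℝ E) (F : Module.Dual ℝ E) : Set (E × Module.Dual ℝ E) :=
  {σ : E × Module.Dual ℝ E | σ.1 ∈ N ∧ ∀ v ∈ N, σ.2 v = F v}

/-- A product of submodules is linearly equivalent to their product as types. -/
def Submodule.prodLinearEquivProd {R M M' : Type*} [Semiring R] [AddCommMonoid M]
    [AddCommMonoid M'] [Module R M] [Module R M'] (p : Submodule R M) (q : Submodule R M') :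
    p.prod q ≃ₗ[R] p × q where
  toFun x := (⟨x.1.1, x.2.1⟩, ⟨x.1.2, x.2.2⟩)
  invFun x := ⟨(x.1, x.2), x.1.2, x.2.2⟩
  map_add' _ _ := rfl
  map_smul' _ _ := rfl

theorem Submodule.finrank_prod_eq_add {K V W : Type*} [DivisionRing K] [AddCommGroup V]
    [AddCommGroup W] [Module K V] [Module K W] [FiniteDimensional K V] [FiniteDimensional K W]
    (p : Submodule K V) (q : Submodule K W) :
    Module.finrank K (p.prod q) = Module.finrank K p + Module.finrank K q := by
  rw [(p.prodLinearEquivProd q).finrank_eq, Module.finrank_prod]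

/-- **Linear model of Tulczyjew's theorem.** `Σ_F` is the affine subspace through
`(0,F)` with direction subspace `N × N°`, and it is affine-Lagrangian for the
canonical symplectic pairing `ω ((x,ξ),(y,η)) = η x - ξ y` on `E × E*`:
`ω (σ₁ - σ₂, σ₃ - σ₂) = 0` for all `σ₁, σ₂, σ₃ ∈ Σ_F`, and the direction subspace
`N × N°` has dimension `dim E = ½ dim (E × E*)`. -/
theorem sigmaF_affine_lagrangian
    (E : Type*) [AddCommGroup E] [Module ℝ E] [FiniteDimensional ℝ E]
    (N : Submodule ℝ E) (F : Module.Dual ℝ E) :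
    (SigmaF E N F
      = {σ : E × Module.Dual ℝ E |
          ∃ x ∈ N, ∃ ξ ∈ N.dualAnnihilator, σ = (x, F + ξ)}) ∧
    (∀ σ₁ ∈ SigmaF E N F, ∀ σ₂ ∈ SigmaF E N F, ∀ σ₃ ∈ SigmaF E N F,
        (σ₃.2 - σ₂.2) (σ₁.1 - σ₂.1) - (σ₁.2 - σ₂.2) (σ₃.1 - σ₂.1) = 0) ∧
    Module.finrank ℝ (N.prod N.dualAnnihilator) = Module.finrank ℝ E ∧
    2 * Module.finrank ℝ E = Module.finrank ℝ (E × Module.Dual ℝ E) := by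
  refine ⟨?_, ?_, ?_, ?_⟩
  · ext ⟨x, p⟩
    constructor
    · rintro ⟨hx, hp⟩
      refine ⟨x, hx, p - F, (Submodule.mem_dualAnnihilator _).2 fun v hv => ?_, by simp⟩
      rw [LinearMap.sub_apply, hp v hv, sub_self]
    · rintro ⟨y, hy, ξ, hξ, h⟩
      obtain ⟨rfl, rfl⟩ := Prod.mk.inj h
      refine ⟨hy, fun v hv => ?_⟩
      simp [(Submodule.mem_dualAnnihilator _).1 hξ v hv]
  · rintro σ₁ ⟨hx₁, hp₁⟩ σ₂ ⟨hx₂, hp₂⟩ σ₃ ⟨hx₃, hp₃⟩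
    have h₁ := N.sub_mem hx₁ hx₂
    have h₃ := N.sub_mem hx₃ hx₂
    rw [LinearMap.sub_apply, LinearMap.sub_apply, hp₃ _ h₁, hp₂ _ h₁, hp₁ _ h₃, hp₂ _ h₃]
    ring
  · exact (Submodule.finrank_prod_eq_add N N.dualAnnihilator).trans
      (Subspace.finrank_add_finrank_dualAnnihilator_eq N)
  · rw [Module.finrank_prod, Subspace.dual_finrank_eq, two_mul]
end

section
/- Let E be a real normed vector space and H : E × E → ℝ twice continuously differentiable, and let G(q,p) = (fderiv ℝ H (q,p))(0,p) − H(q,p) be the coordinate expression of Δ*H − H. Fix (q,p) ∈ E × E and let Z ∈ E be a vertical direction in the kernel of the fiber Hessian of H at (q,p), i.e. (fderiv ℝ (fun x => fderiv ℝ H x) (q,p) (0,Z))(0,w) = 0 for all w ∈ E. Then the derivative of G at (q,p) in the direction (0,Z) vanishes: fderiv ℝ G (q,p) (0,Z) = 0. (This is the computation by which the paper shows that, for an almost-regular Hamiltonian H, the function Δ*H − H is constant on the connected fibers of the fiber derivative 𝔽H, so that it projects to a well-defined Lagrangian L : C → ℝ with L ∘ 𝔽H = Δ*H − H.) -/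
/-- **The function `G = Δ*H − H` is infinitesimally constant along the fibers of the
fiber derivative `𝔽H`.** Here `G (q,p) = (fderiv ℝ H (q,p)) (0,p) - H (q,p)` is the
coordinate expression of `Δ*H − H` (with `Δ*` the Liouville dilation field `p ∂/∂p`).
If `Z` is a vertical direction in the kernel of the fiber Hessian of `H` at `(q,p)`,
then the derivative of `G` at `(q,p)` in the direction `(0,Z)` vanishes. -/
theorem liouville_energy_vertical_derivative_vanishes
    (E : Type*) [NormedAddCommGroup E] [NormedSpace ℝ E]
    (H : E × E → ℝ) (hH : ContDiff ℝ 2 H)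
    (q p Z : E)
    (hZ : ∀ w : E, fderiv ℝ (fun x => fderiv ℝ H x) (q, p) (0, Z) (0, w) = 0) :
    fderiv ℝ (fun qp : E × E => fderiv ℝ H qp (0, qp.2) - H qp) (q, p) (0, Z) = 0 := by
  have hdH : HasFDerivAt (fderiv ℝ H) (fderiv ℝ (fderiv ℝ H) (q, p)) (q, p) :=
    ((hH.fderiv_right (m := 1) (by norm_num)).differentiable one_ne_zero (q, p)).hasFDerivAt
  have hH' : HasFDerivAt H (fderiv ℝ H (q, p)) (q, p) :=
    (hH.differentiable two_ne_zero (q, p)).hasFDerivAt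
  have hliouville : HasFDerivAt (fun qp : E × E => ((0 : E), qp.2))
      ((ContinuousLinearMap.inr ℝ E E).comp (ContinuousLinearMap.snd ℝ E E)) (q, p) :=
    ((ContinuousLinearMap.inr ℝ E E).comp (ContinuousLinearMap.snd ℝ E E)).hasFDerivAt
  rw [((hdH.clm_apply hliouville).fun_sub hH').fderiv]
  simpa using hZ p
end

section
/- Let L : (Fin m → ℝ) × (Fin k → ℝ) → ℝ and Ψ : (Fin m → ℝ) × (Fin k → ℝ) → (Fin l → ℝ) be of class C². Define the constrained Legendre transformation in adapted coordinates, F : (Fin m → ℝ) × (Fin k → ℝ) × (Fin l → ℝ) → (Fin m → ℝ) × (Fin k → ℝ) × (Fin l → ℝ), by F(q,u,μ) = (q, (a ↦ ∂L/∂u_a(q,u) − Σ_α μ(α)·∂Ψ_α/∂u_a(q,u)), μ). Then at any point (q,u,μ) the derivative fderiv ℝ F (q,u,μ) is a bijective linear map if and only if the k × k real matrix with entries A(a,b) = ∂²L/∂u_a∂u_b(q,u) − Σ_α μ(α)·∂²Ψ_α/∂u_a∂u_b(q,u) is invertible. (This is the paper's criterion: the constrained variational system (L,C), with C locally given by q̇^α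 = Ψ^α(qⁱ, q̇^a), is regular if and only if the matrix (∂²L/∂q̇^a∂q̇^b − μ̃_α ∂²Ψ^α/∂q̇^a∂q̇^b) is nondegenerate.) -/
/-- A linear map that is the identity on the outer factors of `E × V × R` is bijective iff its
restriction to the middle factor is. -/
theorem bijective_prodMk_middle_iff {K E V R : Type*} [Ring K] [AddCommGroup E] [AddCommGroup V]
    [AddCommGroup R] [Module K E] [Module K V] [Module K R] (g : E × V × R →ₗ[K] V) :
    Function.Bijective (fun x : E × V × R => (x.1, g x, x.2.2)) ↔
      Function.Bijective (fun v : V => g (0, v, 0)) := by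
  have split (e : E) (v : V) (r : R) : g (e, v, r) = g (0, v, 0) + g (e, 0, r) := by
    rw [← map_add]; simp
  constructor
  · rintro ⟨hi, hs⟩
    refine ⟨fun v w h => ?_, fun w => ?_⟩
    · have := @hi (0, v, 0) (0, w, 0) (by simpa using h)
      simpa using this
    · obtain ⟨⟨e, v, r⟩, h⟩ := hs (0, w, 0)
      simp only [Prod.mk.injEq] at h
      obtain ⟨rfl, h, rfl⟩ := h
      exact ⟨v, h⟩
  · rintro ⟨hi, hs⟩
    refine ⟨?_, ?_⟩
    · rintro ⟨e, v, r⟩ ⟨e', v', r'⟩ h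
      simp only [Prod.mk.injEq] at h
      obtain ⟨rfl, h, rfl⟩ := h
      rw [split e v, split e v', add_left_inj] at h
      rw [hi h]
    · rintro ⟨e, w, r⟩
      obtain ⟨v, h⟩ := hs (w - g (e, 0, r))
      refine ⟨(e, v, r), ?_⟩
      simp only at h
      simp [split e v, h]

theorem bijective_vecMul_iff_isUnit {n K : Type*} [Fintype n] [DecidableEq n] [Field K]
    (A : Matrix n n K) : Function.Bijective (fun v => Matrix.vecMul v A) ↔ IsUnit A :=
  ⟨fun h => Matrix.vecMul_injective_iff_isUnit.1 h.1,
    fun h => ⟨Matrix.vecMul_injective_iff_isUnit.2 h, Matrix.vecMul_surjective_iff_isUnit.2 h⟩⟩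

theorem ContDiff.differentiable_fderiv_apply {E F : Type*} [NormedAddCommGroup E]
    [NormedSpace ℝ E] [NormedAddCommGroup F] [NormedSpace ℝ F] {f : E → F}
    (hf : ContDiff ℝ 2 f) (v : E) : Differentiable ℝ (fun x => fderiv ℝ f x v) :=
  ((hf.fderiv_right (m := 1) (by norm_num)).differentiable (by norm_num)).clm_apply
    (differentiable_const v)

theorem LinearMap.apply_zero_prodMk_eq_sum {E K : Type*} [CommRing K] [AddCommGroup E] [Module K E]
    {n : Type*} [Fintype n] [DecidableEq n] (f : E × (n → K) →ₗ[K] K) (v : n → K) :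
    f (0, v) = ∑ b, v b * f (0, Pi.single b 1) := by
  have h := map_sum (f ∘ₗ LinearMap.inr K E (n → K)) (fun b => v b • Pi.single b (1 : K))
    Finset.univ
  rw [← pi_eq_sum_univ' v] at h
  simpa only [map_smul, LinearMap.comp_apply, LinearMap.inr_apply, smul_eq_mul] using h

/-- The derivative of `(q, u, μ) ↦ φ (q, u) - ∑ α, μ α * ψ α (q, u)` in the direction of `u`. -/
theorem exists_hasFDerivAt_sub_sum_mul {E V ι : Type*} [NormedAddCommGroup E] [NormedSpace ℝ E]
    [NormedAddCommGroup V] [NormedSpace ℝ V] [Fintype ι] {φ : E × V → ℝ} {ψ : ι → E × V → ℝ}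
    (hφ : Differentiable ℝ φ) (hψ : ∀ α, Differentiable ℝ (ψ α)) (q : E) (u : V) (μ : ι → ℝ) :
    ∃ g : E × V × (ι → ℝ) →L[ℝ] ℝ,
      HasFDerivAt (fun x : E × V × (ι → ℝ) =>
        φ (x.1, x.2.1) - ∑ α, x.2.2 α * ψ α (x.1, x.2.1)) g (q, u, μ) ∧
      ∀ v, g (0, v, 0) = fderiv ℝ φ (q, u) (0, v) - ∑ α, μ α * fderiv ℝ (ψ α) (q, u) (0, v) := by
  have hp : HasFDerivAt (fun x : E × V × (ι → ℝ) => (x.1, x.2.1)) _ (q, u, μ) :=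
    hasFDerivAt_fst.prodMk (hasFDerivAt_snd (𝕜 := ℝ) (p := (q, u, μ))).fst
  have hμ (α : ι) : HasFDerivAt (fun x : E × V × (ι → ℝ) => x.2.2 α) _ (q, u, μ) :=
    ((ContinuousLinearMap.proj (R := ℝ) (φ := fun _ : ι => ℝ) α).comp
      ((ContinuousLinearMap.snd ℝ V (ι → ℝ)).comp
        (ContinuousLinearMap.snd ℝ E (V × (ι → ℝ))))).hasFDerivAt
  refine ⟨_, ((hφ (q, u)).hasFDerivAt.comp (q, u, μ) hp).sub
    (HasFDerivAt.fun_sum fun α _ =>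
      (hμ α).mul ((hψ α (q, u)).hasFDerivAt.comp (q, u, μ) hp)), fun v => ?_⟩
  simp

/-- **Regularity criterion for the constrained Legendre transformation.**
In adapted coordinates, with constraints `q̇^α = Ψ^α(qⁱ, q̇^a)`, the constrained
Legendre transformation
`F (q,u,μ) = (q, (a ↦ ∂L/∂u_a - Σ_α μ α · ∂Ψ_α/∂u_a), μ)`
has bijective derivative at `(q,u,μ)` iff the `k × k` matrix
`A a b = ∂²L/∂u_a∂u_b - Σ_α μ α · ∂²Ψ_α/∂u_a∂u_b` is invertible. -/
theorem constrained_legendre_regular_iff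
    (m k l : ℕ)
    (L : (Fin m → ℝ) × (Fin k → ℝ) → ℝ)
    (Ψ : (Fin m → ℝ) × (Fin k → ℝ) → (Fin l → ℝ))
    (hL : ContDiff ℝ 2 L) (hΨ : ContDiff ℝ 2 Ψ)
    (q : Fin m → ℝ) (u : Fin k → ℝ) (μ : Fin l → ℝ) :
    Function.Bijective
      (fderiv ℝ (fun x : (Fin m → ℝ) × (Fin k → ℝ) × (Fin l → ℝ) =>
        ((x.1,
          fun a : Fin k =>
            fderiv ℝ L (x.1, x.2.1) (0, Pi.single a 1)
              - ∑ α : Fin l, x.2.2 α *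
                  fderiv ℝ (fun y => Ψ y α) (x.1, x.2.1) (0, Pi.single a 1),
          x.2.2) : (Fin m → ℝ) × (Fin k → ℝ) × (Fin l → ℝ)))
        (q, u, μ))
    ↔ IsUnit (Matrix.of (fun a b : Fin k =>
        fderiv ℝ (fun x => fderiv ℝ L x (0, Pi.single b 1)) (q, u) (0, Pi.single a 1)
          - ∑ α : Fin l, μ α *
              fderiv ℝ (fun x => fderiv ℝ (fun y => Ψ y α) x (0, Pi.single b 1))
                (q, u) (0, Pi.single a 1))) := by
  have hΨα (α : Fin l) : ContDiff ℝ 2 (fun y => Ψ y α) := contDiff_pi.1 hΨ α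
  choose g hg hgv using fun a : Fin k => exists_hasFDerivAt_sub_sum_mul
    (hL.differentiable_fderiv_apply (0, Pi.single a 1))
    (fun α => (hΨα α).differentiable_fderiv_apply (0, Pi.single a 1)) q u μ
  have hF := (hasFDerivAt_fst (𝕜 := ℝ) (p := (q, u, μ))).prodMk
    ((hasFDerivAt_pi.2 hg).prodMk hasFDerivAt_snd.snd)
  rw [← bijective_vecMul_iff_isUnit, HasFDerivAt.fderiv hF]
  refine (bijective_prodMk_middle_iff (ContinuousLinearMap.pi g).toLinearMap).trans
    (iff_of_eq (congrArg _ (funext fun v => funext fun a => ?_)))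
  have hsum (f : (Fin m → ℝ) × (Fin k → ℝ) →L[ℝ] ℝ) :
      f (0, v) = ∑ b, v b * f (0, Pi.single b 1) :=
    LinearMap.apply_zero_prodMk_eq_sum f.toLinearMap v
  simp only [ContinuousLinearMap.coe_coe, ContinuousLinearMap.coe_pi', hgv, Matrix.vecMul,
    dotProduct, Matrix.of_apply, mul_sub, Finset.sum_sub_distrib]
  rw [hsum]
  congr 1
  simp_rw [Finset.mul_sum]
  rw [Finset.sum_comm]
  refine Finset.sum_congr rfl fun α _ => ?_
  rw [hsum, Finset.mul_sum]
  exact Finset.sum_congr rfl fun b _ => mul_left_comm _ _ _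
end

section
/- Let m = k + l, and let L_d : (Fin m → ℝ) × (Fin k → ℝ) → ℝ and Ψ_d : (Fin m → ℝ) × (Fin k → ℝ) → (Fin l → ℝ) be of class C². Define the discrete constrained Legendre transformation in adapted coordinates, F⁻ : (Fin m → ℝ) × (Fin k → ℝ) × (Fin l → ℝ) → (Fin m → ℝ) × (Fin m → ℝ), by F⁻(q₀,u,μ) = (q₀, (i ↦ −∂L_d/∂(q₀)_i(q₀,u) + Σ_α μ(α)·∂(Ψ_d)_α/∂(q₀)_i(q₀,u))). Then at any point (q₀,u,μ) the derivative fderiv ℝ F⁻ (q₀,u,μ) is a bijective linear map if and only if the m × m real matrix whose k columns indexed by a are A_{i a} = ∂²L_d/∂(q₀)_i∂u_a(q₀,u) − Σ_α μ(α)·∂²(Ψ_d)_α/∂(q₀)_i∂u_a(q₀,u) and whose l columns indexed by α are A_{i α} = ∂(Ψ_d)_α/∂(q₀)_i(q₀,u) is invertible. (This is the paper's criterion: the discrete constrained system (L_d, C_d), with C_d locally given by q₁^α = Ψ_d^α(q₀ⁱ, q₁^a), is regular if and only if the matrix (A_{ia}, A_{iα}) is nondegenerate.) -/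
theorem fderiv_fderiv_apply_comm {E : Type*} [NormedAddCommGroup E] [NormedSpace ℝ E]
    {f : E → ℝ} (hf : ContDiff ℝ 2 f) (p v w : E) :
    fderiv ℝ (fun x => fderiv ℝ f x v) p w = fderiv ℝ (fun x => fderiv ℝ f x w) p v := by
  have hd : DifferentiableAt ℝ (fderiv ℝ f) p :=
    (hf.fderiv_right (m := 1) (by norm_num)).differentiable one_ne_zero p
  have key (v : E) : fderiv ℝ (fun x => fderiv ℝ f x v) p = (fderiv ℝ (fderiv ℝ f) p).flip v := by
    simpa using (hd.hasFDerivAt.clm_apply (hasFDerivAt_const v p)).fderiv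
  rw [key, key]
  exact hf.contDiffAt.isSymmSndFDerivAt (by simp) w v

theorem ContDiff.differentiable_fderiv_apply_const {E : Type*} [NormedAddCommGroup E]
    [NormedSpace ℝ E] {f : E → ℝ} (hf : ContDiff ℝ 2 f) (v : E) :
    Differentiable ℝ (fun x => fderiv ℝ f x v) :=
  ((hf.fderiv_right (m := 1) (by norm_num)).differentiable one_ne_zero).clm_apply
    (differentiable_const v)

theorem ContinuousLinearMap.map_zero_prod_eq_sum {E ι : Type*} [NormedAddCommGroup E]
    [NormedSpace ℝ E] [Fintype ι] [DecidableEq ι] (T : E × (ι → ℝ) →L[ℝ] ℝ) (w : ι → ℝ) :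
    T (0, w) = ∑ a, T (0, Pi.single a 1) * w a := by
  have h := LinearMap.pi_apply_eq_sum_univ (T.toLinearMap ∘ₗ LinearMap.inr ℝ E (ι → ℝ)) w
  have hsingle (a : ι) : (Pi.single a 1 : ι → ℝ) = fun j => if a = j then 1 else 0 := by
    ext j
    simp [Pi.single_apply, eq_comm]
  simpa [mul_comm, hsingle] using h

/-- A linear map covering the identity of the base is bijective iff its restriction to the
fibre over zero is. -/
theorem bijective_iff_of_fst_eq {V W V' : Type*} [AddCommGroup V] [Module ℝ V] [AddCommGroup W]
    [Module ℝ W] [AddCommGroup V'] [Module ℝ V'] (D : V × W →ₗ[ℝ] V × V')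
    (hD : ∀ z, (D z).1 = z.1) :
    Function.Bijective D ↔ Function.Bijective fun w => (D (0, w)).2 := by
  constructor
  · rintro ⟨hi, hs⟩
    refine ⟨fun a b h => ?_, fun y => ?_⟩
    · exact (Prod.ext_iff.1 (hi (Prod.ext (by simp [hD]) h))).2
    · obtain ⟨⟨a, b⟩, h⟩ := hs (0, y)
      obtain rfl : a = 0 := by simpa [h] using (hD (a, b)).symm
      exact ⟨b, by simp [h]⟩
  · rintro ⟨hi, hs⟩
    refine ⟨fun x y h => ?_, fun y => ?_⟩
    · have h1 : x.1 = y.1 := by rw [← hD x, h, hD]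
      have split (z : V × W) : D z = D (z.1, 0) + D (0, z.2) := by rw [← map_add]; simp
      rw [split x, split y, h1] at h
      exact Prod.ext h1 (hi (congrArg Prod.snd (add_left_cancel h)))
    · obtain ⟨w, hw⟩ := hs (y.2 - (D (y.1, 0)).2)
      refine ⟨(y.1, 0) + (0, w), ?_⟩
      rw [map_add]
      refine Prod.ext (by simp [hD]) ?_
      simp only [Prod.snd_add] at hw ⊢
      rw [hw]; abel

theorem Matrix.bijective_mulVec_iff_isUnit {n : Type*} [Fintype n] [DecidableEq n]
    (A : Matrix n n ℝ) : Function.Bijective A.mulVec ↔ IsUnit A :=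
  ⟨fun h => Matrix.mulVec_injective_iff_isUnit.1 h.1, fun h =>
    ⟨Matrix.mulVec_injective_iff_isUnit.2 h, Matrix.mulVec_surjective_iff_isUnit.2 h⟩⟩

/-- Concatenation of vectors, with the sign of the first one reversed. -/
def negAppendEquiv (k l : ℕ) : (Fin k → ℝ) × (Fin l → ℝ) ≃ (Fin (k + l) → ℝ) :=
  ((Equiv.neg _).prodCongr (Equiv.refl _)).trans
    ((Equiv.sumArrowEquivProdArrow _ _ _).symm.trans (finSumFinEquiv.arrowCongr (Equiv.refl _)))

theorem mulVec_negAppendEquiv {k l : ℕ} {n : Type*} (B : n → Fin k ⊕ Fin l → ℝ)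
    (w : Fin k → ℝ) (ν : Fin l → ℝ) (i : n) :
    (Matrix.of fun i j => B i (finSumFinEquiv.symm j)).mulVec (negAppendEquiv k l (w, ν)) i =
      -(∑ a, B i (Sum.inl a) * w a) + ∑ α, B i (Sum.inr α) * ν α := by
  simp only [Matrix.mulVec, dotProduct, Matrix.of_apply]
  rw [← finSumFinEquiv.sum_comp, Fintype.sum_sum_type]
  simp [negAppendEquiv, Equiv.sumArrowEquivProdArrow]


/-- **Regularity criterion for the discrete constrained Legendre transformation.**
Let `m = k + l`. In adapted coordinates, with discrete constraints
`q₁^α = Ψ_d^α(q₀ⁱ, q₁^a)`, the discrete constrained Legendre transformation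
`F⁻ (q₀,u,μ) = (q₀, (i ↦ -∂L_d/∂(q₀)_i + Σ_α μ α · ∂(Ψ_d)_α/∂(q₀)_i))`
has bijective derivative at `(q₀,u,μ)` iff the `m × m` matrix whose columns indexed
by `a : Fin k` are `A_{ia} = ∂²L_d/∂(q₀)_i∂u_a - Σ_α μ α · ∂²(Ψ_d)_α/∂(q₀)_i∂u_a`
and whose columns indexed by `α : Fin l` are `A_{iα} = ∂(Ψ_d)_α/∂(q₀)_i` is
invertible. -/
theorem discrete_constrained_legendre_regular_iff
    (k l : ℕ)
    (Ld : (Fin (k + l) → ℝ) × (Fin k → ℝ) → ℝ)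
    (Ψd : (Fin (k + l) → ℝ) × (Fin k → ℝ) → (Fin l → ℝ))
    (hL : ContDiff ℝ 2 Ld) (hΨ : ContDiff ℝ 2 Ψd)
    (q₀ : Fin (k + l) → ℝ) (u : Fin k → ℝ) (μ : Fin l → ℝ) :
    Function.Bijective
      (fderiv ℝ (fun x : (Fin (k + l) → ℝ) × (Fin k → ℝ) × (Fin l → ℝ) =>
        ((x.1,
          fun i : Fin (k + l) =>
            - fderiv ℝ Ld (x.1, x.2.1) (Pi.single i 1, 0)
              + ∑ α : Fin l, x.2.2 α *
                  fderiv ℝ (fun y => Ψd y α) (x.1, x.2.1) (Pi.single i 1, 0)) :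
          (Fin (k + l) → ℝ) × (Fin (k + l) → ℝ)))
        (q₀, u, μ))
    ↔ IsUnit (Matrix.of (fun i j : Fin (k + l) =>
        Sum.elim
          (fun a : Fin k =>
            fderiv ℝ (fun x => fderiv ℝ Ld x (0, Pi.single a 1)) (q₀, u)
                (Pi.single i 1, 0)
              - ∑ α : Fin l, μ α *
                  fderiv ℝ (fun x => fderiv ℝ (fun y => Ψd y α) x (0, Pi.single a 1))
                    (q₀, u) (Pi.single i 1, 0))
          (fun α : Fin l =>
            fderiv ℝ (fun y => Ψd y α) (q₀, u) (Pi.single i 1, 0))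
          (finSumFinEquiv.symm j))) := by
  have hΨ' (α : Fin l) : ContDiff ℝ 2 fun y => Ψd y α := contDiff_pi.1 hΨ α
  let p : ((Fin (k + l) → ℝ) × (Fin k → ℝ) × (Fin l → ℝ)) →L[ℝ]
      (Fin (k + l) → ℝ) × (Fin k → ℝ) :=
    (ContinuousLinearMap.fst ℝ _ _).prod
      ((ContinuousLinearMap.fst ℝ _ _).comp (ContinuousLinearMap.snd ℝ _ _))
  let c (α : Fin l) : ((Fin (k + l) → ℝ) × (Fin k → ℝ) × (Fin l → ℝ)) →L[ℝ] ℝ :=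
    (ContinuousLinearMap.proj α).comp
      ((ContinuousLinearMap.snd ℝ _ _).comp (ContinuousLinearMap.snd ℝ _ _))
  have hpull {f : (Fin (k + l) → ℝ) × (Fin k → ℝ) → ℝ} (hf : ContDiff ℝ 2 f)
      (i : Fin (k + l)) :
      HasFDerivAt (fun x : (Fin (k + l) → ℝ) × (Fin k → ℝ) × (Fin l → ℝ) =>
          fderiv ℝ f (x.1, x.2.1) (Pi.single i 1, 0))
        ((fderiv ℝ (fun y => fderiv ℝ f y (Pi.single i 1, 0)) (q₀, u)).comp p) (q₀, u, μ) :=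
    HasFDerivAt.comp (f := p) (q₀, u, μ)
      (hf.differentiable_fderiv_apply_const _ _).hasFDerivAt p.hasFDerivAt
  have hF := (hasFDerivAt_fst (𝕜 := ℝ) (p := (q₀, u, μ))).prodMk
    (hasFDerivAt_pi.2 fun i : Fin (k + l) =>
      (hpull hL i).neg.add (HasFDerivAt.fun_sum (u := Finset.univ) fun α _ =>
        (c α).hasFDerivAt.mul (hpull (hΨ' α) i)))
  refine (iff_of_eq (congrArg (fun T : _ →L[ℝ] _ => Function.Bijective T) hF.fderiv)).trans ?_
  refine (bijective_iff_of_fst_eq (ContinuousLinearMap.toLinearMap _) fun z => rfl).trans ?_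
  rw [← Matrix.bijective_mulVec_iff_isUnit, ← (negAppendEquiv k l).bijective.of_comp_iff]
  refine iff_of_eq (congrArg _ (funext fun ⟨w, ν⟩ => funext fun i => ?_))
  rw [Function.comp_apply, mulVec_negAppendEquiv (fun i => Sum.elim _ _)]
  have hsymm {f : (Fin (k + l) → ℝ) × (Fin k → ℝ) → ℝ} (hf : ContDiff ℝ 2 f) :
      fderiv ℝ (fun y => fderiv ℝ f y (Pi.single i 1, 0)) (q₀, u) (0, w) =
        ∑ a, fderiv ℝ (fun y => fderiv ℝ f y (0, Pi.single a 1)) (q₀, u) (Pi.single i 1, 0)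
          * w a := by
    rw [ContinuousLinearMap.map_zero_prod_eq_sum]
    simp only [fderiv_fderiv_apply_comm hf (q₀, u) (Pi.single i 1, 0)]
  simp [p, c, hsymm hL, hsymm (hΨ' _), sub_mul, Finset.sum_add_distrib, Finset.sum_mul,
    Finset.mul_sum]
  rw [Finset.sum_comm]
  simp only [mul_assoc]
  ring
end

section
/- Let M be a symmetric invertible real n × n matrix, V : (Fin n → ℝ) → ℝ, and h ∈ ℝ with h ≠ 0. Define the mechanical Hamiltonian H(q,p) = ½·(p ⬝ᵥ M⁻¹.mulVec p) + V(q) and the mechanical Lagrangian L(q,v) = ½·(v ⬝ᵥ M.mulVec v) − V(q). For q₀, q₁ ∈ (Fin n → ℝ) set p = h⁻¹ • M.mulVec (q₁ − q₀). Then: (i) q₁ = q₀ + (h/2) • (M⁻¹.mulVec p + M⁻¹.mulVec p), i.e. p is the unique intermediate momentum determined by the second Störmer–Verlet equation; and (ii) p ⬝ᵥ (q₁ − q₀) − (h/2)·(H(q₀,p) + H(q₁,p)) = (h/2)·L(q₀, h⁻¹ • (q₁ − q₀)) + (h/2)·L(q₁, h⁻¹ • (q₁ − q₀)). Hence the type-1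 generating function of the Störmer–Verlet method projects, for a regular mechanical system, to the discrete Lagrangian L_d(q₀,q₁) = (h/2)L(q₀,(q₁−q₀)/h) + (h/2)L(q₁,(q₁−q₀)/h). -/
open Matrix

/-- **The Störmer–Verlet type-1 generating function projects to the discrete
Lagrangian for a regular mechanical system.** With `H q p = ½ p M⁻¹ p + V q`,
`L q v = ½ v M v − V q`, and the intermediate momentum `p = h⁻¹ • M(q₁ − q₀)`:
(i) `q₁ = q₀ + (h/2)(M⁻¹p + M⁻¹p)` (the second Störmer–Verlet equation), and
(ii) `p·(q₁−q₀) − (h/2)(H q₀ p + H q₁ p)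
      = (h/2) L q₀ ((q₁−q₀)/h) + (h/2) L q₁ ((q₁−q₀)/h)`. -/
theorem stormer_verlet_projects_to_discrete_lagrangian
    (n : ℕ) (M : Matrix (Fin n) (Fin n) ℝ) (hsym : M.IsSymm) (hM : IsUnit M)
    (V : (Fin n → ℝ) → ℝ) (h : ℝ) (hh : h ≠ 0)
    (H L : (Fin n → ℝ) → (Fin n → ℝ) → ℝ)
    (hH : ∀ q p, H q p = (1 / 2) * (p ⬝ᵥ M⁻¹.mulVec p) + V q)
    (hL : ∀ q v, L q v = (1 / 2) * (v ⬝ᵥ M.mulVec v) - V q)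
    (q₀ q₁ p : Fin n → ℝ) (hp : p = h⁻¹ • M.mulVec (q₁ - q₀)) :
    q₁ = q₀ + (h / 2) • (M⁻¹.mulVec p + M⁻¹.mulVec p) ∧
    p ⬝ᵥ (q₁ - q₀) - (h / 2) * (H q₀ p + H q₁ p)
      = (h / 2) * L q₀ (h⁻¹ • (q₁ - q₀)) + (h / 2) * L q₁ (h⁻¹ • (q₁ - q₀)) := by
  have hdet : IsUnit M.det := (Matrix.isUnit_iff_isUnit_det M).mp hM
  have hinv : M⁻¹.mulVec p = h⁻¹ • (q₁ - q₀) := by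
    rw [hp, Matrix.mulVec_smul, Matrix.mulVec_mulVec, Matrix.nonsing_inv_mul M hdet,
      Matrix.one_mulVec]
  refine ⟨?_, ?_⟩
  · rw [hinv, ← two_smul ℝ, smul_smul, smul_smul,
      show h / 2 * 2 * h⁻¹ = 1 by field_simp, one_smul, add_sub_cancel]
  · rw [hH, hH, hL, hL, hinv, hp, Matrix.mulVec_smul]
    simp only [smul_dotProduct, dotProduct_smul, smul_eq_mul]
    rw [dotProduct_comm (M.mulVec (q₁ - q₀))]
    field_simp
    ring
end

section
/- Consider a configuration space with adapted coordinates split as (x,y) ∈ (Fin k → ℝ) × (Fin l → ℝ), a C² Lagrangian 𝕃 : ((Fin k → ℝ) × (Fin l → ℝ)) × ((Fin k → ℝ) × (Fin l → ℝ)) → ℝ (second group of arguments are the velocities (u,v)), and a C¹ matrix-valued map φ : (Fin k → ℝ) × (Fin l → ℝ) → Matrix (Fin l) (Fin k) ℝ defining the linear constraints v^α = Σ_a φ^α_a(x,y)·u^a. Let q = (x,y) : ℝ → (Fin k → ℝ) × (Fin l → ℝ) be differentiable with derivative q̇ = (ẋ,ẏ), let λ, μ : ℝ → (Fin l → ℝ)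 be differentiable, and let p, π : ℝ → (Fin k → ℝ) × (Fin l → ℝ) be differentiable. Assume for all t: (c) ẏ(t) = φ(q(t)).mulVec ẋ(t); (nonholonomic equations) p_a(t) = ∂𝕃/∂u_a(q(t),q̇(t)), p_α(t) = ∂𝕃/∂v_α(q(t),q̇(t)), ṗ_a(t) = ∂𝕃/∂x_a(q(t),q̇(t)) − Σ_α λ_α(t)·φ^α_a(q(t)), ṗ_α(t) = ∂𝕃/∂y_α(q(t),q̇(t)) + λ_α(t); (variational constrained equations) π_a(t) = ∂𝕃/∂u_a(q(t),q̇(t)) − Σ_α μ_α(t)·φ^α_a(q(t)), π_α(t) = ∂𝕃/∂v_α(q(t),q̇(t)) + μ_α(t), π̇_a(t) = ∂𝕃/∂x_a(q(t),q̇(t)) − Σ_{α,b} μ_α(t)·(∂φ^α_b/∂x_a)(q(t))·ẋ^b(t), π̇_α(t) = ∂𝕃/∂y_α(q(t),q̇(t)) − Σ_{β,b} μ_β(t)·(∂φ^β_b/∂y_α)(q(t))·ẋ^b(t). Then for all t and every index a ∈ Fin k: Σ_{b,α} ẋ^b(t)·μ_α(t)·R^α_{ab}(q(t)) = 0, where R^α_{ab}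 = ∂φ^α_b/∂x_a − ∂φ^α_a/∂x_b + Σ_β (φ^β_a·∂φ^α_b/∂y_β − φ^β_b·∂φ^α_a/∂y_β) is the curvature of the associated connection. (This is the paper's compatibility condition q̇^a μ_α R^α_{ab} = 0 that any common solution of the nonholonomic and variationally constrained dynamics for linear constraints must satisfy.) -/
open Matrix

/-- A linear map on `(Fin k → ℝ) × (Fin l → ℝ)` expanded along the standard basis. -/
lemma ContinuousLinearMap.apply_eq_sum_single_prod {k l : ℕ}
    (L : (Fin k → ℝ) × (Fin l → ℝ) →L[ℝ] ℝ) (v : (Fin k → ℝ) × (Fin l → ℝ)) :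
    L v = ∑ b, v.1 b * L (Pi.single b 1, 0) + ∑ β, v.2 β * L (0, Pi.single β 1) := by
  have hx := LinearMap.pi_apply_eq_sum_univ
    (L.comp (ContinuousLinearMap.inl ℝ (Fin k → ℝ) (Fin l → ℝ))).toLinearMap v.1
  have hy := LinearMap.pi_apply_eq_sum_univ
    (L.comp (ContinuousLinearMap.inr ℝ (Fin k → ℝ) (Fin l → ℝ))).toLinearMap v.2
  have hv : L v = L (v.1, 0) + L (0, v.2) := by simp [← map_add]
  have hs {n : ℕ} (i : Fin n) : (fun j => if i = j then (1 : ℝ) else 0) = Pi.single i 1 := by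
    ext j
    simp [Pi.single_apply, eq_comm]
  simp only [ContinuousLinearMap.coe_coe, ContinuousLinearMap.comp_apply,
    ContinuousLinearMap.inl_apply, ContinuousLinearMap.inr_apply, smul_eq_mul, hs] at hx hy
  rw [hv, hx, hy]

/-- **Compatibility condition between the nonholonomic and the variationally
constrained dynamics for linear constraints.** In adapted coordinates `(x,y)` with
linear constraints `ẏ^α = Σ_a φ^α_a(x,y) ẋ^a`, any curve which solves
simultaneously the nonholonomic equations (with multiplier `λ`, momenta `p`) and
the variational constrained equations (with multiplier `μ`, momenta `π`) satisfies
`Σ_{b,α} ẋ^b μ_α R^α_{ab} = 0`, where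
`R^α_{ab} = ∂φ^α_b/∂x_a − ∂φ^α_a/∂x_b + Σ_β (φ^β_a ∂φ^α_b/∂y_β − φ^β_b ∂φ^α_a/∂y_β)`
is the curvature of the associated connection. -/
theorem nonholonomic_variational_curvature_compatibility
    (k l : ℕ)
    (𝕃 : ((Fin k → ℝ) × (Fin l → ℝ)) × ((Fin k → ℝ) × (Fin l → ℝ)) → ℝ)
    (φ : (Fin k → ℝ) × (Fin l → ℝ) → Matrix (Fin l) (Fin k) ℝ)
    (h𝕃 : ContDiff ℝ 2 𝕃)
    (hφ : ∀ (α : Fin l) (a : Fin k), ContDiff ℝ 1 (fun z => φ z α a))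
    (q q' p p' piv piv' : ℝ → (Fin k → ℝ) × (Fin l → ℝ))
    (lam μ : ℝ → Fin l → ℝ)
    (hq : ∀ t, HasDerivAt q (q' t) t)
    (hp : ∀ t, HasDerivAt p (p' t) t)
    (hpiv : ∀ t, HasDerivAt piv (piv' t) t)
    (hlam : Differentiable ℝ lam) (hμ : Differentiable ℝ μ)
    -- the constraints: ẏ = φ(q) ẋ
    (hc : ∀ t, (q' t).2 = (φ (q t)).mulVec (q' t).1)
    -- nonholonomic equations
    (hnh1 : ∀ t a, (p t).1 a
        = fderiv ℝ 𝕃 (q t, q' t) ((0, 0), (Pi.single a 1, 0)))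
    (hnh2 : ∀ t α, (p t).2 α
        = fderiv ℝ 𝕃 (q t, q' t) ((0, 0), (0, Pi.single α 1)))
    (hnh3 : ∀ t a, (p' t).1 a
        = fderiv ℝ 𝕃 (q t, q' t) ((Pi.single a 1, 0), (0, 0))
          - ∑ α, lam t α * φ (q t) α a)
    (hnh4 : ∀ t α, (p' t).2 α
        = fderiv ℝ 𝕃 (q t, q' t) ((0, Pi.single α 1), (0, 0)) + lam t α)
    -- variational constrained equations
    (hv1 : ∀ t a, (piv t).1 a
        = fderiv ℝ 𝕃 (q t, q' t) ((0, 0), (Pi.single a 1, 0))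
          - ∑ α, μ t α * φ (q t) α a)
    (hv2 : ∀ t α, (piv t).2 α
        = fderiv ℝ 𝕃 (q t, q' t) ((0, 0), (0, Pi.single α 1)) + μ t α)
    (hv3 : ∀ t a, (piv' t).1 a
        = fderiv ℝ 𝕃 (q t, q' t) ((Pi.single a 1, 0), (0, 0))
          - ∑ α, ∑ b, μ t α *
              fderiv ℝ (fun z => φ z α b) (q t) (Pi.single a 1, 0) * (q' t).1 b)
    (hv4 : ∀ t α, (piv' t).2 α
        = fderiv ℝ 𝕃 (q t, q' t) ((0, Pi.single α 1), (0, 0))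
          - ∑ β, ∑ b, μ t β *
              fderiv ℝ (fun z => φ z β b) (q t) (0, Pi.single α 1) * (q' t).1 b) :
    ∀ t, ∀ a : Fin k,
      ∑ b : Fin k, ∑ α : Fin l, (q' t).1 b * μ t α *
        (fderiv ℝ (fun z => φ z α b) (q t) (Pi.single a 1, 0)
          - fderiv ℝ (fun z => φ z α a) (q t) (Pi.single b 1, 0)
          + ∑ β : Fin l,
              (φ (q t) β a * fderiv ℝ (fun z => φ z α b) (q t) (0, Pi.single β 1)
                - φ (q t) β b * fderiv ℝ (fun z => φ z α a) (q t) (0, Pi.single β 1)))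
        = 0 := by
  intro t a
  have hp1 : HasDerivAt (fun s => (p s).1 a) ((p' t).1 a) t := hasDerivAt_pi.1 (hp t).fst a
  have hp2 (α : Fin l) : HasDerivAt (fun s => (p s).2 α) ((p' t).2 α) t :=
    hasDerivAt_pi.1 (hp t).snd α
  have hpiv1 : HasDerivAt (fun s => (piv s).1 a) ((piv' t).1 a) t :=
    hasDerivAt_pi.1 (hpiv t).fst a
  have hpiv2 (α : Fin l) : HasDerivAt (fun s => (piv s).2 α) ((piv' t).2 α) t :=
    hasDerivAt_pi.1 (hpiv t).snd α
  have hμ' (α : Fin l) : HasDerivAt (fun s => μ s α) ((piv' t).2 α - (p' t).2 α) t := by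
    have h : (fun s => μ s α) = fun s => (piv s).2 α - (p s).2 α := by
      ext s
      rw [hv2, hnh2]
      ring
    rw [h]
    exact (hpiv2 α).sub (hp2 α)
  have hφ' (α : Fin l) :
      HasDerivAt (fun s => φ (q s) α a) (fderiv ℝ (fun z => φ z α a) (q t) (q' t)) t :=
    (((hφ α a).differentiable one_ne_zero (q t)).hasFDerivAt).comp_hasDerivAt t (hq t)
  have hsum : HasDerivAt (fun s => (p s).1 a - ∑ α, μ s α * φ (q s) α a)
      ((p' t).1 a - ∑ α, (((piv' t).2 α - (p' t).2 α) * φ (q t) α a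
        + μ t α * fderiv ℝ (fun z => φ z α a) (q t) (q' t))) t :=
    hp1.sub (HasDerivAt.fun_sum fun α _ => (hμ' α).mul (hφ' α))
  have hfun : (fun s => (piv s).1 a) = fun s => (p s).1 a - ∑ α, μ s α * φ (q s) α a := by
    ext s
    rw [hv1, hnh1]
  have key := (hfun ▸ hpiv1).unique hsum
  have hconstr (β : Fin l) : (q' t).2 β = ∑ b, φ (q t) β b * (q' t).1 b := by
    rw [hc t]
    rfl
  simp only [hv3, hnh3, hv4, hnh4, ContinuousLinearMap.apply_eq_sum_single_prod _ (q' t),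
    hconstr] at key
  have hlin : ∑ α, ∑ b, μ t α * fderiv ℝ (fun z => φ z α b) (q t) (Pi.single a 1, 0) * (q' t).1 b
      + ∑ α, (∑ β, ∑ b, μ t β * fderiv ℝ (fun z => φ z β b) (q t) (0, Pi.single α 1)
          * (q' t).1 b) * φ (q t) α a
      - ∑ α, μ t α * (∑ b, (q' t).1 b * fderiv ℝ (fun z => φ z α a) (q t) (Pi.single b 1, 0)
          + ∑ β, (∑ b, φ (q t) β b * (q' t).1 b)
            * fderiv ℝ (fun z => φ z α a) (q t) (0, Pi.single β 1)) = 0 := by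
    simp only [sub_mul, add_mul, Finset.sum_add_distrib, Finset.sum_sub_distrib] at key
    linarith
  rw [← hlin]
  simp only [mul_add, mul_sub, Finset.mul_sum, Finset.sum_mul, Finset.sum_add_distrib,
    Finset.sum_sub_distrib]
  have h1 : ∑ b, ∑ α, (q' t).1 b * μ t α * fderiv ℝ (fun z => φ z α b) (q t) (Pi.single a 1, 0)
      = ∑ α, ∑ b, μ t α * fderiv ℝ (fun z => φ z α b) (q t) (Pi.single a 1, 0)
        * (q' t).1 b := by
    rw [Finset.sum_comm]
    exact Finset.sum_congr rfl fun α _ => Finset.sum_congr rfl fun b _ => by ring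
  have h2 : ∑ b, ∑ α, (q' t).1 b * μ t α * fderiv ℝ (fun z => φ z α a) (q t) (Pi.single b 1, 0)
      = ∑ α, ∑ b, μ t α
        * ((q' t).1 b * fderiv ℝ (fun z => φ z α a) (q t) (Pi.single b 1, 0)) := by
    rw [Finset.sum_comm]
    exact Finset.sum_congr rfl fun α _ => Finset.sum_congr rfl fun b _ => by ring
  have h3 : ∑ b, ∑ α, ∑ β, (q' t).1 b * μ t α
        * (φ (q t) β a * fderiv ℝ (fun z => φ z α b) (q t) (0, Pi.single β 1))
      = ∑ β, ∑ α, ∑ b, μ t α * fderiv ℝ (fun z => φ z α b) (q t) (0, Pi.single β 1)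
        * (q' t).1 b * φ (q t) β a := by
    rw [Finset.sum_comm, Finset.sum_comm (s := (Finset.univ : Finset (Fin l)))
      (t := (Finset.univ : Finset (Fin l)))]
    refine Finset.sum_congr rfl fun α _ => ?_
    rw [Finset.sum_comm]
    exact Finset.sum_congr rfl fun β _ => Finset.sum_congr rfl fun b _ => by ring
  have h4 : ∑ b, ∑ α, ∑ β, (q' t).1 b * μ t α
        * (φ (q t) β b * fderiv ℝ (fun z => φ z α a) (q t) (0, Pi.single β 1))
      = ∑ α, ∑ β, ∑ b, μ t α * (φ (q t) β b * (q' t).1 b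
        * fderiv ℝ (fun z => φ z α a) (q t) (0, Pi.single β 1)) := by
    rw [Finset.sum_comm]
    refine Finset.sum_congr rfl fun α _ => ?_
    rw [Finset.sum_comm]
    exact Finset.sum_congr rfl fun β _ => Finset.sum_congr rfl fun b _ => by ring
  rw [h1, h2, h3, h4]
  ring
end
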